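/- Let R be a commutative ring and let A = R[χ₁^{±1}, χ₂^{±1}] be the Laurent polynomial ring in two variables. The R-algebra homomorphism φ from R[x₁^{±1}, x₂^{±1}, x₃^{±1}] to the product ring A × A × A determined by x₁ ↦ (χ₁, 1, χ₁χ₂^{−1}), x₂ ↦ (χ₂, χ₁^{−1}χ₂, 1), x₃ ↦ (1, χ₁^{−1}, χ₂^{−1}) has kernel equal to the principal ideal generated by (x₁ − 1)(x₂ − 1)(x₃ − 1), and its image equals the subring {(f₁, f₂, f₃) ∈ A³ : f₁ − f₂ ∈ (1 − χ₁)A, f₁ − f₃ ∈ (1 − χ₂)A, f₂ − f₃ ∈ (1 − χ₁^{−1}χ₂)A}. -/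

import Mathlib

/-!
STATEMENT 1: Comparison of the Reisner–Stanley and GKM presentations of the
T-equivariant K-theory of the toric surface ℙ².

`A = R[χ₁^{±1}, χ₂^{±1}]` is realized as the group algebra `AddMonoidAlgebra R (ℤ × ℤ)`,
with `χ₁ = single (1,0) 1` and `χ₂ = single (0,1) 1`.
`R[x₁^{±1}, x₂^{±1}, x₃^{±1}]` is realized as `AddMonoidAlgebra R (ℤ × ℤ × ℤ)`, with
`xᵢ` the monomial with the i-th standard basis exponent vector.
The product ring `A × A × A` is realized as `Fin 3 → A`.
-/

/-- The Laurent monomial with exponent vector `v` in `R[x₁^{±1}, x₂^{±1}, x₃^{±1}]`. -/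
noncomputable abbrev xMon (R : Type*) [CommRing R] (v : ℤ × ℤ × ℤ) :
    AddMonoidAlgebra R (ℤ × ℤ × ℤ) :=
  AddMonoidAlgebra.single v 1

/-- The Laurent monomial with exponent vector `v` in `A = R[χ₁^{±1}, χ₂^{±1}]`. -/
noncomputable abbrev chiMon (R : Type*) [CommRing R] (v : ℤ × ℤ) :
    AddMonoidAlgebra R (ℤ × ℤ) :=
  AddMonoidAlgebra.single v 1

namespace AddMonoidAlgebra

variable {R G B : Type*} [CommRing R] [AddCommGroup G] [CommRing B] [Algebra R B]

/-- Two algebra homomorphisms out of a group algebra that agree on the monomials of a generating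
set of the group are equal. -/
theorem algHom_ext_of_closure_eq_top {S : Set G} (hS : AddSubgroup.closure S = ⊤)
    {f g : AddMonoidAlgebra R G →ₐ[R] B} (h : ∀ v ∈ S, f (single v 1) = g (single v 1)) :
    f = g := by
  refine AddMonoidAlgebra.algHom_ext (fun v => ?_) (Subsingleton.elim _ _)
  have hv : v ∈ AddSubgroup.closure S := hS ▸ AddSubgroup.mem_top v
  induction hv using AddSubgroup.closure_induction with
  | mem v hv => exact h v hv
  | zero => rw [← one_def, map_one, map_one]
  | add v w _ _ hv hw =>
    rw [← mul_one (1 : R), ← single_mul_single, map_mul, map_mul, hv, hw]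
  | neg v _ hv =>
    have key : (single (-v) 1 * single v 1 : AddMonoidAlgebra R G) = 1 := by
      rw [single_mul_single, neg_add_cancel, mul_one, one_def]
    have hf := congrArg f key
    have hg := congrArg g key
    rw [map_mul, map_one] at hf hg
    rw [← hv] at hg
    exact (IsUnit.of_mul_eq_one_right _ hf).mul_right_cancel (hf.trans hg.symm)

/-- Two algebra homomorphisms out of a group algebra that are congruent modulo an ideal on the
monomials of a generating set of the group are congruent everywhere. -/
theorem algHom_sub_mem_of_closure_eq_top {S : Set G} (hS : AddSubgroup.closure S = ⊤)
    (f g : AddMonoidAlgebra R G →ₐ[R] B) (I : Ideal B)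
    (h : ∀ v ∈ S, f (single v 1) - g (single v 1) ∈ I) (a : AddMonoidAlgebra R G) :
    f a - g a ∈ I := by
  have key : (Ideal.Quotient.mkₐ R I).comp f = (Ideal.Quotient.mkₐ R I).comp g :=
    algHom_ext_of_closure_eq_top hS fun v hv => Ideal.Quotient.eq.2 (h v hv)
  exact Ideal.Quotient.eq.1 (DFunLike.congr_fun key a)

/-- In the group algebra of a torsion-free group, `single v 1 - 1` is not a zero divisor for
`v ≠ 0`. -/
theorem eq_zero_of_single_sub_one_mul_eq_zero [IsAddTorsionFree G] {v : G} (hv : v ≠ 0)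
    {a : AddMonoidAlgebra R G} (h : (single v 1 - 1) * a = 0) : a = 0 := by
  have hper : ∀ w, a.coeff (-v + w) = a.coeff w := fun w => by
    have h' : single v 1 * a = a := by rwa [sub_mul, one_mul, sub_eq_zero] at h
    have := congrArg (fun b => b.coeff w) h'
    simpa using this
  have hiter : ∀ (n : ℕ) (w : G), a.coeff (-(n • v) + w) = a.coeff w := fun n => by
    induction n with
    | zero => simp
    | succ n ih =>
      intro w
      rw [succ_nsmul, neg_add, add_assoc, ih, hper]
  by_contra ha
  obtain ⟨w, hw⟩ : ∃ w, a.coeff w ≠ 0 := by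
    by_contra! hall
    exact ha (AddMonoidAlgebra.ext (Finsupp.ext hall))
  have hinj : Function.Injective fun n : ℕ => -(n • v) + w := fun m n hmn =>
    injective_nsmul_iff_not_isOfFinAddOrder.2 (not_isOfFinAddOrder_of_isAddTorsionFree hv)
      (neg_injective (add_right_cancel hmn))
  exact Set.infinite_of_injective_forall_mem hinj
    (fun n => by simpa [hiter n w] using hw) a.coeff.support.finite_toSet

end AddMonoidAlgebra

theorem AddSubgroup.closure_basis_int_prod :
    AddSubgroup.closure ({(1, 0), (0, 1)} : Set (ℤ × ℤ)) = ⊤ := by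
  refine (AddSubgroup.eq_top_iff' _).2 fun ⟨a, b⟩ => ?_
  have h : ((a, b) : ℤ × ℤ) = a • (1, 0) + b • (0, 1) := by simp
  rw [h]
  exact add_mem (zsmul_mem (subset_closure (by simp)) a) (zsmul_mem (subset_closure (by simp)) b)

theorem AddSubgroup.closure_basis_int_prod_prod :
    AddSubgroup.closure ({(1, 0, 0), (0, 1, 0), (0, 0, 1)} : Set (ℤ × ℤ × ℤ)) = ⊤ := by
  refine (AddSubgroup.eq_top_iff' _).2 fun ⟨a, b, c⟩ => ?_
  have h : ((a, b, c) : ℤ × ℤ × ℤ) = a • (1, 0, 0) + b • (0, 1, 0) + c • (0, 0, 1) := by simp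
  rw [h]
  exact add_mem (add_mem (zsmul_mem (subset_closure (by simp)) a)
    (zsmul_mem (subset_closure (by simp)) b)) (zsmul_mem (subset_closure (by simp)) c)

section LaurentMonomials

variable {R : Type*} [CommRing R]

theorem chiMon_mul (v w : ℤ × ℤ) : chiMon R v * chiMon R w = chiMon R (v + w) := by
  simp [chiMon]

theorem chiMon_zero : chiMon R 0 = 1 := rfl

theorem xMon_zero : xMon R 0 = 1 := rfl

/-- The kernel of an algebra homomorphism `p` out of `R[x₁^{±1}, x₂^{±1}, x₃^{±1}]` lies in an ideal
`I` as soon as some `s ∘ p` is the identity modulo `I` on the variables. -/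
theorem mem_of_apply_eq_zero_of_section {C : Type*} [CommRing C] [Algebra R C]
    (p : AddMonoidAlgebra R (ℤ × ℤ × ℤ) →ₐ[R] C) (s : C →ₐ[R] AddMonoidAlgebra R (ℤ × ℤ × ℤ))
    (I : Ideal (AddMonoidAlgebra R (ℤ × ℤ × ℤ)))
    (h₁ : xMon R (1, 0, 0) - s (p (xMon R (1, 0, 0))) ∈ I)
    (h₂ : xMon R (0, 1, 0) - s (p (xMon R (0, 1, 0))) ∈ I)
    (h₃ : xMon R (0, 0, 1) - s (p (xMon R (0, 0, 1))) ∈ I)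
    {b : AddMonoidAlgebra R (ℤ × ℤ × ℤ)} (hb : p b = 0) : b ∈ I := by
  have h := AddMonoidAlgebra.algHom_sub_mem_of_closure_eq_top
    AddSubgroup.closure_basis_int_prod_prod (AlgHom.id R _) (s.comp p) I
    (by rintro v (rfl | rfl | rfl) <;> assumption) b
  simpa [hb] using h

/-- `1 - χ₂` is not a zero divisor modulo `1 - χ₁⁻¹χ₂`. -/
theorem mem_span_of_one_sub_mul_mem_span {a : AddMonoidAlgebra R (ℤ × ℤ)}
    (h : a * (1 - chiMon R (0, 1)) ∈ Ideal.span {1 - chiMon R (-1, 1)}) :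
    a ∈ Ideal.span {1 - chiMon R (-1, 1)} := by
  let e : AddMonoidAlgebra R (ℤ × ℤ) →ₐ[R] AddMonoidAlgebra R (ℤ × ℤ) :=
    AddMonoidAlgebra.mapDomainAlgHom R R
      (AddMonoidHom.mk' (fun v : ℤ × ℤ => ((0, v.1 + v.2) : ℤ × ℤ))
        fun v w => by ext <;> simp; ring)
  have he : ∀ v : ℤ × ℤ, e (chiMon R v) = chiMon R (0, v.1 + v.2) := fun v => by
    simp [e, chiMon]
  obtain ⟨c, hc⟩ := Ideal.mem_span_singleton'.1 h
  have hea : e a = 0 := by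
    refine AddMonoidAlgebra.eq_zero_of_single_sub_one_mul_eq_zero (v := ((0, 1) : ℤ × ℤ))
      (by simp) ?_
    have h' := congrArg e hc
    simp only [map_mul, map_sub, map_one, he] at h'
    norm_num at h'
    have h0 : chiMon R (0, 0) = 1 := chiMon_zero
    rw [h0] at h'
    linear_combination h'
  have key := AddMonoidAlgebra.algHom_sub_mem_of_closure_eq_top
    AddSubgroup.closure_basis_int_prod (AlgHom.id R _) e (Ideal.span {1 - chiMon R (-1, 1)}) (by
      rintro v (rfl | rfl)
      · refine Ideal.mem_span_singleton'.2 ⟨chiMon R (1, 0), ?_⟩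
        rw [he, mul_sub, mul_one, chiMon_mul]
        simp
      · rw [he]
        simp) a
  simpa [hea] using key

end LaurentMonomials

theorem stmt_1 (R : Type*) [CommRing R]
    -- φ is the R-algebra homomorphism determined by
    -- x₁ ↦ (χ₁, 1, χ₁χ₂⁻¹), x₂ ↦ (χ₂, χ₁⁻¹χ₂, 1), x₃ ↦ (1, χ₁⁻¹, χ₂⁻¹)
    (φ : AddMonoidAlgebra R (ℤ × ℤ × ℤ) →ₐ[R] (Fin 3 → AddMonoidAlgebra R (ℤ × ℤ)))
    (hx1 : φ (xMon R (1, 0, 0)) =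
      ![chiMon R (1, 0), 1, chiMon R (1, 0) * chiMon R (0, -1)])
    (hx2 : φ (xMon R (0, 1, 0)) =
      ![chiMon R (0, 1), chiMon R (-1, 0) * chiMon R (0, 1), 1])
    (hx3 : φ (xMon R (0, 0, 1)) =
      ![1, chiMon R (-1, 0), chiMon R (0, -1)]) :
    -- the kernel of φ is the principal ideal generated by (x₁ − 1)(x₂ − 1)(x₃ − 1)
    RingHom.ker φ =
      Ideal.span {(xMon R (1, 0, 0) - 1) * (xMon R (0, 1, 0) - 1) * (xMon R (0, 0, 1) - 1)} ∧
    -- the image of φ equals the subring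
    -- {(f₁,f₂,f₃) ∈ A³ : f₁−f₂ ∈ (1−χ₁)A, f₁−f₃ ∈ (1−χ₂)A, f₂−f₃ ∈ (1−χ₁⁻¹χ₂)A}
    (φ.range : Set (Fin 3 → AddMonoidAlgebra R (ℤ × ℤ))) =
      {f | f 0 - f 1 ∈ Ideal.span {1 - chiMon R (1, 0)} ∧
           f 0 - f 2 ∈ Ideal.span {1 - chiMon R (0, 1)} ∧
           f 1 - f 2 ∈ Ideal.span {1 - chiMon R (-1, 0) * chiMon R (0, 1)}} := by
  let p (i : Fin 3) : AddMonoidAlgebra R (ℤ × ℤ × ℤ) →ₐ[R] AddMonoidAlgebra R (ℤ × ℤ) :=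
    (Pi.evalAlgHom R (fun _ : Fin 3 => AddMonoidAlgebra R (ℤ × ℤ)) i).comp φ
  have hp : ∀ i b, p i b = φ b i := fun _ _ => rfl
  let s (σ : ℤ × ℤ →+ ℤ × ℤ × ℤ) :
      AddMonoidAlgebra R (ℤ × ℤ) →ₐ[R] AddMonoidAlgebra R (ℤ × ℤ × ℤ) :=
    AddMonoidAlgebra.mapDomainAlgHom R R σ
  have hs : ∀ σ v, s σ (chiMon R v) = xMon R (σ v) := fun σ v => by simp [s, chiMon, xMon]
  let σ₀ : ℤ × ℤ →+ ℤ × ℤ × ℤ := AddMonoidHom.mk' (fun v => (v.1, v.2, 0))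
    fun v w => by simp
  let σ₁ : ℤ × ℤ →+ ℤ × ℤ × ℤ := AddMonoidHom.mk' (fun v => (0, v.2, -v.1 - v.2))
    fun v w => by simp; ring
  let σ₂ : ℤ × ℤ →+ ℤ × ℤ × ℤ := AddMonoidHom.mk' (fun v => (v.1, 0, -v.1 - v.2))
    fun v w => by simp; ring
  have hσ₀ : ∀ v, σ₀ v = (v.1, v.2, 0) := fun _ => rfl
  have hσ₁ : ∀ v, σ₁ v = (0, v.2, -v.1 - v.2) := fun _ => rfl
  have hσ₂ : ∀ v, σ₂ v = (v.1, 0, -v.1 - v.2) := fun _ => rfl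
  have hc0 : chiMon R (0, 0) = 1 := chiMon_zero
  have hx0 : xMon R (0, 0, 0) = 1 := xMon_zero
  simp only [chiMon_mul, Prod.mk_add_mk, add_zero, zero_add] at hx1 hx2 hx3 ⊢
  have hp01 : p 0 (xMon R (1, 0, 0)) = chiMon R (1, 0) := by simp [hp, hx1]
  have hp02 : p 0 (xMon R (0, 1, 0)) = chiMon R (0, 1) := by simp [hp, hx2]
  have hp03 : p 0 (xMon R (0, 0, 1)) = 1 := by simp [hp, hx3]
  have hp11 : p 1 (xMon R (1, 0, 0)) = 1 := by simp [hp, hx1]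
  have hp12 : p 1 (xMon R (0, 1, 0)) = chiMon R (-1, 1) := by simp [hp, hx2]
  have hp13 : p 1 (xMon R (0, 0, 1)) = chiMon R (-1, 0) := by simp [hp, hx3]
  have hp21 : p 2 (xMon R (1, 0, 0)) = chiMon R (1, -1) := by simp [hp, hx1]
  have hp22 : p 2 (xMon R (0, 1, 0)) = 1 := by simp [hp, hx2]
  have hp23 : p 2 (xMon R (0, 0, 1)) = chiMon R (0, -1) := by simp [hp, hx3]
  have ker0 : ∀ b, p 0 b = 0 → b ∈ Ideal.span {xMon R (0, 0, 1) - 1} := fun b hb =>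
    mem_of_apply_eq_zero_of_section (p 0) (s σ₀) _ (by simp [hp01, hs, hσ₀])
      (by simp [hp02, hs, hσ₀]) (by simp [hp03]) hb
  have ker1 : ∀ b, p 1 b = 0 → b ∈ Ideal.span {xMon R (1, 0, 0) - 1} := fun b hb =>
    mem_of_apply_eq_zero_of_section (p 1) (s σ₁) _
      (by simp [hp11])
      (by simp [hp12, hs, hσ₁]) (by simp [hp13, hs, hσ₁]) hb
  have ker2 : ∀ b, p 2 b = 0 → b ∈ Ideal.span {xMon R (0, 1, 0) - 1} := fun b hb =>
    mem_of_apply_eq_zero_of_section (p 2) (s σ₂) _ (by simp [hp21, hs, hσ₂])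
      (by simp [hp22]) (by simp [hp23, hs, hσ₂]) hb
  have hX : chiMon R (1, 0) * chiMon R (-1, 0) = 1 := by simp [hc0]
  have hY : chiMon R (0, 1) * chiMon R (0, -1) = 1 := by simp [hc0]
  have hXY : chiMon R (-1, 1) = chiMon R (-1, 0) * chiMon R (0, 1) := by simp
  have hXY' : chiMon R (1, -1) = chiMon R (1, 0) * chiMon R (0, -1) := by simp
  have hxz : xMon R (0, 0, 1) * xMon R (0, 0, -1) = 1 := by simp [hx0]
  have hxy : xMon R (0, 1, -1) = xMon R (0, 1, 0) * xMon R (0, 0, -1) := by simp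
  have hxx : xMon R (1, 0, -1) = xMon R (1, 0, 0) * xMon R (0, 0, -1) := by simp
  have hp1z : p 1 (xMon R (0, 0, -1)) = chiMon R (1, 0) := by
    have h := congrArg (p 1) hxz
    rw [map_mul, map_one, hp13] at h
    linear_combination chiMon R (1, 0) * h - p 1 (xMon R (0, 0, -1)) * hX
  have hp2z : p 2 (xMon R (0, 0, -1)) = chiMon R (0, 1) := by
    have h := congrArg (p 2) hxz
    rw [map_mul, map_one, hp23] at h
    linear_combination chiMon R (0, 1) * h - p 2 (xMon R (0, 0, -1)) * hY
  have sec0 : ∀ a, p 0 (s σ₀ a) = a := DFunLike.congr_fun (f := (p 0).comp (s σ₀))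
    (g := AlgHom.id R _) (AddMonoidAlgebra.algHom_ext_of_closure_eq_top
      AddSubgroup.closure_basis_int_prod (by
        rintro v (rfl | rfl)
        · simp [hs, hσ₀, hp01]
        · simp [hs, hσ₀, hp02]))
  have sec1 : ∀ a, p 1 (s σ₁ a) = a := DFunLike.congr_fun (f := (p 1).comp (s σ₁))
    (g := AlgHom.id R _) (AddMonoidAlgebra.algHom_ext_of_closure_eq_top
      AddSubgroup.closure_basis_int_prod (by
        rintro v (rfl | rfl)
        · simp [hs, hσ₁, hp1z]
        · change p 1 (s σ₁ (chiMon R (0, 1))) = chiMon R (0, 1)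
          have h : σ₁ (0, 1) = (0, 1, -1) := by simp [hσ₁]
          rw [hs, h, hxy, map_mul, hp12, hp1z]
          simp))
  have sec2 : ∀ a, p 2 (s σ₂ a) = a := DFunLike.congr_fun (f := (p 2).comp (s σ₂))
    (g := AlgHom.id R _) (AddMonoidAlgebra.algHom_ext_of_closure_eq_top
      AddSubgroup.closure_basis_int_prod (by
        rintro v (rfl | rfl)
        · change p 2 (s σ₂ (chiMon R (1, 0))) = chiMon R (1, 0)
          have h : σ₂ (1, 0) = (1, 0, -1) := by simp [hσ₂]
          rw [hs, h, hxx, map_mul, hp21, hp2z]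
          simp
        · simp [hs, hσ₂, hp2z]))
  have gkm01 : ∀ b, p 0 b - p 1 b ∈ Ideal.span {1 - chiMon R (1, 0)} :=
    AddMonoidAlgebra.algHom_sub_mem_of_closure_eq_top
      AddSubgroup.closure_basis_int_prod_prod _ _ _ (by
        rintro v (rfl | rfl | rfl) <;> refine Ideal.mem_span_singleton'.2 ?_
        · exact ⟨-1, by rw [hp01, hp11]; ring⟩
        · exact ⟨-chiMon R (-1, 1), by
            rw [hp02, hp12, hXY]; linear_combination chiMon R (0, 1) * hX⟩
        · exact ⟨-chiMon R (-1, 0), by rw [hp03, hp13]; linear_combination hX⟩)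
  have gkm02 : ∀ b, p 0 b - p 2 b ∈ Ideal.span {1 - chiMon R (0, 1)} :=
    AddMonoidAlgebra.algHom_sub_mem_of_closure_eq_top
      AddSubgroup.closure_basis_int_prod_prod _ _ _ (by
        rintro v (rfl | rfl | rfl) <;> refine Ideal.mem_span_singleton'.2 ?_
        · exact ⟨-chiMon R (1, -1), by
            rw [hp01, hp21, hXY']; linear_combination chiMon R (1, 0) * hY⟩
        · exact ⟨-1, by rw [hp02, hp22]; ring⟩
        · exact ⟨-chiMon R (0, -1), by rw [hp03, hp23]; linear_combination hY⟩)
  have gkm12 : ∀ b, p 1 b - p 2 b ∈ Ideal.span {1 - chiMon R (-1, 1)} :=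
    AddMonoidAlgebra.algHom_sub_mem_of_closure_eq_top
      AddSubgroup.closure_basis_int_prod_prod _ _ _ (by
        rintro v (rfl | rfl | rfl) <;> refine Ideal.mem_span_singleton'.2 ?_
        · exact ⟨-chiMon R (1, -1), by
            rw [hp11, hp21, hXY, hXY']
            linear_combination chiMon R (0, 1) * chiMon R (0, -1) * hX + hY⟩
        · exact ⟨-1, by rw [hp12, hp22]; ring⟩
        · exact ⟨-chiMon R (0, -1), by
            rw [hp13, hp23, hXY]; linear_combination chiMon R (-1, 0) * hY⟩)
  refine ⟨le_antisymm (fun b hb => ?_) ?_, Set.ext fun f => ⟨?_, ?_⟩⟩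
  · have hb : ∀ i, p i b = 0 := fun i => congrFun ((RingHom.mem_ker).1 hb) i
    obtain ⟨c, rfl⟩ := Ideal.mem_span_singleton'.1 (ker0 b (hb 0))
    have hc : p 1 c = 0 := by
      refine AddMonoidAlgebra.eq_zero_of_single_sub_one_mul_eq_zero
        (v := ((-1, 0) : ℤ × ℤ)) (by simp) ?_
      have h := hb 1
      rw [map_mul, map_sub, map_one, hp13] at h
      rw [mul_comm]
      exact h
    obtain ⟨d, rfl⟩ := Ideal.mem_span_singleton'.1 (ker1 c hc)
    have hd : p 2 d = 0 := by
      refine AddMonoidAlgebra.eq_zero_of_single_sub_one_mul_eq_zero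
        (v := ((1, -1) : ℤ × ℤ)) (by simp) ?_
      refine AddMonoidAlgebra.eq_zero_of_single_sub_one_mul_eq_zero
        (v := ((0, -1) : ℤ × ℤ)) (by simp) ?_
      have h := hb 2
      rw [map_mul, map_mul, map_sub, map_sub, map_one, hp21, hp23] at h
      linear_combination h
    obtain ⟨k, rfl⟩ := Ideal.mem_span_singleton'.1 (ker2 d hd)
    exact Ideal.mem_span_singleton'.2 ⟨k, by ring⟩
  · rw [Ideal.span_singleton_le_iff_mem, RingHom.mem_ker]
    refine funext fun i => ?_
    change p i _ = 0
    fin_cases i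
    · simp [hp03]
    · simp [hp11]
    · simp [hp22]
  · rintro ⟨b, rfl⟩
    exact ⟨gkm01 b, gkm02 b, gkm12 b⟩
  · rintro ⟨h01, h02, h12⟩
    obtain ⟨g, hg⟩ := Ideal.mem_span_singleton'.1
      (sub_mem (gkm01 (s σ₀ (f 0))) h01)
    rw [sec0] at hg
    obtain ⟨b, hb0, hb1⟩ : ∃ b, p 0 b = f 0 ∧ p 1 b = f 1 := by
      refine ⟨s σ₀ (f 0) + (xMon R (0, 0, 1) - 1) * s σ₁ (chiMon R (1, 0) * g), ?_, ?_⟩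
      · rw [map_add, map_mul, map_sub, map_one, hp03, sec0]
        ring
      · rw [map_add, map_mul, map_sub, map_one, hp13, sec1]
        linear_combination hg + g * hX
    have h02' := sub_mem (gkm02 b) h02
    have h12' := sub_mem (gkm12 b) h12
    rw [hb0] at h02'
    rw [hb1] at h12'
    rw [sub_sub_sub_cancel_left] at h02' h12'
    obtain ⟨h, hh⟩ := Ideal.mem_span_singleton'.1 h02'
    rw [← hh] at h12'
    obtain ⟨l, rfl⟩ := Ideal.mem_span_singleton'.1 (mem_span_of_one_sub_mul_mem_span h12')
    refine ⟨b + (xMon R (0, 0, 1) - 1) * (xMon R (1, 0, 0) - 1) *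
      s σ₂ (chiMon R (-1, 0) * chiMon R (0, 1) ^ 2 * l), funext fun i => ?_⟩
    change p i _ = f i
    fin_cases i
    · simp [hp03, hb0]
    · simp [hp11, hb1]
    · change p 2 _ = f 2
      have hprod : (chiMon R (0, -1) - 1) * (chiMon R (1, -1) - 1) *
          (chiMon R (-1, 0) * chiMon R (0, 1) ^ 2) =
          (1 - chiMon R (-1, 1)) * (1 - chiMon R (0, 1)) := by
        have hfac₁ : (chiMon R (0, -1) - 1) * chiMon R (0, 1) = 1 - chiMon R (0, 1) := by
          linear_combination hY
        have hfac₂ : (chiMon R (1, -1) - 1) * (chiMon R (-1, 0) * chiMon R (0, 1)) =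
            1 - chiMon R (-1, 1) := by
          rw [hXY, hXY']
          linear_combination chiMon R (0, 1) * chiMon R (0, -1) * hX + hY
        rw [← hfac₁, ← hfac₂]
        ring
      simp only [map_add, map_mul (p 2), map_sub, map_one, hp21, hp23, sec2]
      linear_combination hh + l * hprod
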